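/- Consider the deterministic MPC setting with horizon N ≥ 1. Suppose Assumption 1 holds (for every x ∈ X there exists u ∈ U with c(x,u) + c_N(f(x,u)) ≤ c_N(x)), and let μ : X → U be an MPC policy for horizon N. Then every finite partial sum of the closed-loop cost is bounded by the computed finite-horizon optimal cost: for every M ∈ ℕ and every x₀ ∈ X, Σ_{k=0}^{M} c(x_k,μ(x_k)) ≤ J_N^⋆(x₀), where x_{k+1} = f(x_k,μ(x_k)). -/

import Mathlib

open scoped ENNReal

noncomputable section

variable {X U : Type*}

/-- Open-loop trajectory: `x_{k+1} = f(x_k, u_k)`. -/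
def traj (f : X → U → X) (x0 : X) (u : ℕ → U) : ℕ → X
  | 0 => x0
  | k + 1 => f (traj f x0 u k) (u k)

/-- `N`-horizon cost `J_N(x0, u) = Σ_{k=0}^{N-1} c(x_k,u_k) + c_N(x_N)`. -/
def costN (f : X → U → X) (c : X → U → NNReal) (cT : X → NNReal)
    (N : ℕ) (x0 : X) (u : ℕ → U) : ℝ≥0∞ :=
  (∑ k ∈ Finset.range N, (c (traj f x0 u k) (u k) : ℝ≥0∞)) +
    (cT (traj f x0 u N) : ℝ≥0∞)

/-- Finite-horizon optimal value function `J_N^⋆(x) = inf_u J_N(x,u)`. -/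
def valN (f : X → U → X) (c : X → U → NNReal) (cT : X → NNReal)
    (N : ℕ) (x : X) : ℝ≥0∞ :=
  ⨅ u : ℕ → U, costN f c cT N x u

/-- Infinite-horizon cost `J_∞(x0, u) = Σ_{k=0}^∞ c(x_k,u_k) ∈ [0,∞]`. -/
def costInf (f : X → U → X) (c : X → U → NNReal) (x0 : X) (u : ℕ → U) : ℝ≥0∞ :=
  ∑' k, (c (traj f x0 u k) (u k) : ℝ≥0∞)

/-- Infinite-horizon optimal value function `J_∞^⋆(x) = inf_u J_∞(x,u)`. -/
def valInf (f : X → U → X) (c : X → U → NNReal) (x : X) : ℝ≥0∞ :=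
  ⨅ u : ℕ → U, costInf f c x u

/-- Closed-loop trajectory under repeated application of policy `μ`. -/
def clTraj (f : X → U → X) (μ : X → U) (x0 : X) : ℕ → X
  | 0 => x0
  | k + 1 => f (clTraj f μ x0 k) (μ (clTraj f μ x0 k))

/-- Achieved infinite-horizon MPC cost `J_∞(x0, μ_MPC)`. -/
def clCost (f : X → U → X) (c : X → U → NNReal) (μ : X → U) (x0 : X) : ℝ≥0∞ :=
  ∑' k, (c (clTraj f μ x0 k) (μ (clTraj f μ x0 k)) : ℝ≥0∞)

theorem traj_update_aux (f : X → U → X) (x : X) (u : ℕ → U) (n : ℕ) (v : U) :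
    ∀ k, k ≤ n → traj f x (Function.update u n v) k = traj f x u k := by
  intro k
  induction k with
  | zero => intro _; rfl
  | succ k ih =>
    intro hk
    have hne : k ≠ n := by omega
    simp only [traj]
    rw [ih (by omega), Function.update_of_ne hne]

theorem valN_succ_le_aux (f : X → U → X) (c : X → U → NNReal) (cT : X → NNReal)
    (hassm : ∀ x : X, ∃ u : U, c x u + cT (f x u) ≤ cT x) (n : ℕ) (x : X) :
    valN f c cT (n + 1) x ≤ valN f c cT n x := by
  unfold valN
  refine le_iInf fun u => ?_
  obtain ⟨v, hv⟩ := hassm (traj f x u n)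
  refine (iInf_le _ (Function.update u n v)).trans ?_
  unfold costN
  rw [Finset.sum_range_succ, add_assoc]
  have h1 : ∑ k ∈ Finset.range n, (c (traj f x (Function.update u n v) k)
      (Function.update u n v k) : ℝ≥0∞) =
      ∑ k ∈ Finset.range n, (c (traj f x u k) (u k) : ℝ≥0∞) := by
    refine Finset.sum_congr rfl fun k hk => ?_
    have hk' := Finset.mem_range.mp hk
    rw [traj_update_aux f x u n v k hk'.le, Function.update_of_ne hk'.ne]
  rw [h1]
  simp only [traj]
  rw [traj_update_aux f x u n v n le_rfl, Function.update_self]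
  gcongr
  exact_mod_cast hv

/-- For an MPC policy `μ` of horizon `N ≥ 1`, under the terminal-cost contraction
assumption, every finite partial sum of the closed-loop cost is bounded by the computed
finite-horizon optimal cost: `Σ_{k=0}^{M} c(x_k,μ(x_k)) ≤ J_N^⋆(x₀)`. -/
theorem stmt_4 [Nonempty X] [Nonempty U]
    (f : X → U → X) (c : X → U → NNReal) (cT : X → NNReal)
    (N : ℕ) (hN : 1 ≤ N)
    (hassm : ∀ x : X, ∃ u : U, c x u + cT (f x u) ≤ cT x)
    (μ : X → U)
    (hμ : ∀ x : X,
      (c x (μ x) : ℝ≥0∞) + valN f c cT (N - 1) (f x (μ x)) = valN f c cT N x)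
    (M : ℕ) (x0 : X) :
    (∑ k ∈ Finset.range (M + 1),
        (c (clTraj f μ x0 k) (μ (clTraj f μ x0 k)) : ℝ≥0∞)) ≤ valN f c cT N x0 := by
  obtain ⟨n, rfl⟩ : ∃ n, N = n + 1 := ⟨N - 1, by omega⟩
  simp only [Nat.add_sub_cancel] at hμ
  have key : ∀ m, (∑ k ∈ Finset.range m,
      (c (clTraj f μ x0 k) (μ (clTraj f μ x0 k)) : ℝ≥0∞)) +
        valN f c cT (n + 1) (clTraj f μ x0 m) ≤ valN f c cT (n + 1) x0 := by
    intro m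
    induction m with
    | zero => simp [clTraj]
    | succ m ih =>
      refine le_trans ?_ ih
      rw [Finset.sum_range_succ, add_assoc, ← hμ (clTraj f μ x0 m)]
      gcongr
      exact valN_succ_le_aux f c cT hassm n _
  exact le_self_add.trans (key (M + 1))
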